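/- θ-integrated leading-order asymptotics: let m ≥ 0 be an even integer, n ≥ m + 3 an integer, and let g(s̄, θ) be continuous in θ and C¹ in s̄ uniformly in θ. Set d_{mn} = ∫_{−∞}^{∞} τ^m/(τ²+1)^{n/2} dτ. There exist constants C > 0 and ε₀ > 0, depending only on m, n, c_Γ, and κ_max, such that for all 0 < ε < ε₀, 0 < δ < ε₀, and every s ∈ ℝ/ℤ, |∫_0^{2π} ∫_{−1/2}^{1/2} s̄^m/(|R(s,s̄,θ)|² + δ²)^{n/2} g(s̄,θ) ds̄ dθ − (ε² + δ²)^{(m+1−n)/2} d_{mn} ∫_0^{2π} g(0,θ) dθ| ≤ C max_{0 ≤ θ < 2π} ‖g(·,θ)‖_{C¹} (ε² + δ²)^{(m+2−n)/2}. -/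

import Mathlib

open MeasureTheory

noncomputable section

local notation "⟪" x ", " y "⟫" => @inner ℝ _ _ x y

abbrev V3 : Type := EuclideanSpace ℝ (Fin 3)

/-- The `C⁰` (sup) norm of a function `ℝ/ℤ → ℝ³`. -/
def C0norm (f : ℝ → V3) : ℝ := ⨆ s : ℝ, ‖f s‖

/-- The `C¹` norm of a function `ℝ/ℤ → ℝ³`. -/
def C1norm (f : ℝ → V3) : ℝ := C0norm f + C0norm (deriv f)

/-- The radial unit vector `e_ρ(s,θ) = cos θ e_{n1}(s) + sin θ e_{n2}(s)`. -/
def ePerp (en1 en2 : ℝ → V3) (s θ : ℝ) : V3 :=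
  Real.cos θ • en1 s + Real.sin θ • en2 s

/-- `R(s, s̄, θ) = X(s) + ε e_ρ(s,θ) − X(s − s̄)`. -/
def Rvec (X en1 en2 : ℝ → V3) (ε s sb θ : ℝ) : V3 :=
  X s + ε • ePerp en1 en2 s θ - X (s - sb)

/-- The slender-body geometry hypotheses: `X : ℝ/ℤ → ℝ³` is a `C²` closed curve
parameterized by arclength, non-self-intersecting with constant `cΓ`, with curvature
bounded by `κmax`, together with a `C¹` orthonormal frame `(X', en1, en2)`. -/
structure SlenderGeom (cΓ κmax : ℝ) (X en1 en2 : ℝ → V3) : Prop where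
  smooth : ContDiff ℝ 2 X
  periodicX : ∀ s, X (s + 1) = X s
  arclength : ∀ s, ‖deriv X s‖ = 1
  no_self_intersect : ∀ s t : ℝ, |s - t| ≤ 1 / 2 → cΓ * |s - t| ≤ ‖X s - X t‖
  curvature_max : ∀ s, ‖deriv (deriv X) s‖ ≤ κmax
  en1_smooth : ContDiff ℝ 1 en1
  en2_smooth : ContDiff ℝ 1 en2
  en1_periodic : ∀ s, en1 (s + 1) = en1 s
  en2_periodic : ∀ s, en2 (s + 1) = en2 s
  en1_unit : ∀ s, ‖en1 s‖ = 1
  en2_unit : ∀ s, ‖en2 s‖ = 1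
  es_en1 : ∀ s, ⟪deriv X s, en1 s⟫ = 0
  es_en2 : ∀ s, ⟪deriv X s, en2 s⟫ = 0
  en1_en2 : ∀ s, ⟪en1 s, en2 s⟫ = 0

/-- The singular Stokeslet `S(y) v = v/|y| + (y·v) y/|y|³`. -/
def stokeslet (y v : V3) : V3 := ‖y‖⁻¹ • v + (‖y‖ ^ 3)⁻¹ • ⟪y, v⟫ • y

/-- The singular doublet `D(y) v = v/|y|³ − 3 (y·v) y/|y|⁵`. -/
def doubletK (y v : V3) : V3 := (‖y‖ ^ 3)⁻¹ • v - (3 * (‖y‖ ^ 5)⁻¹) • ⟪y, v⟫ • y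

/-- The regularized Stokeslet `S_δ(y) v`. -/
def stokesletReg (δ : ℝ) (y v : V3) : V3 :=
  ((‖y‖ ^ 2 + δ ^ 2) ^ ((1 : ℝ) / 2))⁻¹ • v
    + ((‖y‖ ^ 2 + δ ^ 2) ^ ((3 : ℝ) / 2))⁻¹ • (⟪y, v⟫ • y + δ ^ 2 • v)

/-- The regularized doublet `D_δ(y) v`. -/
def doubletReg (δ : ℝ) (y v : V3) : V3 :=
  ((‖y‖ ^ 2 + δ ^ 2) ^ ((3 : ℝ) / 2))⁻¹ • v
    - (3 * ((‖y‖ ^ 2 + δ ^ 2) ^ ((5 : ℝ) / 2))⁻¹) • (⟪y, v⟫ • y + δ ^ 2 • v)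

/-- The classical slender-body velocity `u^SB(x)` with doublet coefficient `ε²/2`. -/
def uSB (X f : ℝ → V3) (ε : ℝ) (x : V3) : V3 :=
  (8 * Real.pi)⁻¹ • ∫ t in (0:ℝ)..1,
    (stokeslet (x - X t) (f t) + (ε ^ 2 / 2) • doubletK (x - X t) (f t))

/-- The regularized slender-body velocity with doublet coefficient `β`. -/
def uReg (X f : ℝ → V3) (β δ : ℝ) (x : V3) : V3 :=
  (8 * Real.pi)⁻¹ • ∫ t in (0:ℝ)..1,
    (stokesletReg δ (x - X t) (f t) + β • doubletReg δ (x - X t) (f t))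

/-- The Keller–Rubinow classical centerline velocity `u^SB_C(X(s))`. -/
def uSBC (X f : ℝ → V3) (ε s : ℝ) : V3 :=
  (8 * Real.pi)⁻¹ •
    ((f s - (3 : ℝ) • ⟪deriv X s, f s⟫ • deriv X s
        - (2 * Real.log (Real.pi * ε / 4)) • (f s + ⟪deriv X s, f s⟫ • deriv X s))
      + ∫ t in (0:ℝ)..1,
          ((‖X s - X t‖⁻¹ • f t
              + (‖X s - X t‖ ^ 3)⁻¹ • ⟪X s - X t, f t⟫ • (X s - X t))
            - |Real.sin (Real.pi * (s - t)) / Real.pi|⁻¹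
                • (f s + ⟪deriv X s, f s⟫ • deriv X s)))

/-- The regularized pressure `p^δ(x)`. -/
def pReg (X f : ℝ → V3) (δ : ℝ) (x : V3) : ℝ :=
  (4 * Real.pi)⁻¹ * ∫ t in (0:ℝ)..1,
    (⟪x - X t, f t⟫ * ((‖x - X t‖ ^ 2 + δ ^ 2) ^ ((3 : ℝ) / 2))⁻¹
      + 3 * δ ^ 2 * ⟪x - X t, f t⟫ * (2 * (‖x - X t‖ ^ 2 + δ ^ 2) ^ ((5 : ℝ) / 2))⁻¹)

/-- The symmetric strain tensor `E(u) = (∇u + (∇u)ᵀ)/2` applied to the vector `n`. -/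
def strainApply (u : V3 → V3) (x n : V3) : V3 :=
  (2 : ℝ)⁻¹ • (fderiv ℝ u x n + gradient (fun y => ⟪u y, n⟫) x)

/-- The surface Jacobian `J_ε(s,θ) = ε(1 − ε(κ₁ cos θ + κ₂ sin θ))`. -/
def Jfac (X en1 en2 : ℝ → V3) (ε s θ : ℝ) : ℝ :=
  ε * (1 - ε * (⟪deriv (deriv X) s, en1 s⟫ * Real.cos θ
      + ⟪deriv (deriv X) s, en2 s⟫ * Real.sin θ))

/-- The regularized surface force density
`f^δ(s) = ∫_0^{2π} (2 E(u^δ) n − p^δ n) J_ε dθ`, with `n = −e_ρ`. -/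
def fReg (X en1 en2 f : ℝ → V3) (ε δ s : ℝ) : V3 :=
  ∫ θ in (0:ℝ)..(2 * Real.pi),
    Jfac X en1 en2 ε s θ •
      ((2 : ℝ) • strainApply (uReg X f ((ε ^ 2 + δ ^ 2) / 2) δ)
          (X s + ε • ePerp en1 en2 s θ) (-ePerp en1 en2 s θ)
        - pReg X f δ (X s + ε • ePerp en1 en2 s θ) • (-ePerp en1 en2 s θ))

/-- The vector field `d_n^δ[f](x)`. -/
def dReg (X f : ℝ → V3) (δ : ℝ) (n : ℕ) (x : V3) : V3 :=
  (8 * Real.pi)⁻¹ • ∫ t in (0:ℝ)..1,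
    (δ ^ 2 * ((‖x - X t‖ ^ 2 + δ ^ 2) ^ ((n : ℝ) / 2))⁻¹) • f t

/-- The scalar field `d_5^δ[f·R](x)`. -/
def dRegP (X f : ℝ → V3) (δ : ℝ) (x : V3) : ℝ :=
  (8 * Real.pi)⁻¹ * ∫ t in (0:ℝ)..1,
    δ ^ 2 * ⟪x - X t, f t⟫ * ((‖x - X t‖ ^ 2 + δ ^ 2) ^ ((5 : ℝ) / 2))⁻¹

/-- The extra force contribution
`F^δ(s) = ∫_0^{2π} (2E(d₃^δ[f])n − 3(ε²+δ²)E(d₅^δ[f])n − 3 d₅^δ[f·R] n) J_ε dθ`. -/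
def Fextra (X en1 en2 f : ℝ → V3) (ε δ s : ℝ) : V3 :=
  ∫ θ in (0:ℝ)..(2 * Real.pi),
    Jfac X en1 en2 ε s θ •
      ((2 : ℝ) • strainApply (dReg X f δ 3) (X s + ε • ePerp en1 en2 s θ)
          (-ePerp en1 en2 s θ)
        - (3 * (ε ^ 2 + δ ^ 2)) • strainApply (dReg X f δ 5)
            (X s + ε • ePerp en1 en2 s θ) (-ePerp en1 en2 s θ)
        - (3 * dRegP X f δ (X s + ε • ePerp en1 en2 s θ)) • (-ePerp en1 en2 s θ))

namespace SlenderGeom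

variable {cΓ κmax : ℝ} {X en1 en2 : ℝ → V3}

lemma curvature_nonneg (hG : SlenderGeom cΓ κmax X en1 en2) : 0 ≤ κmax :=
  (norm_nonneg _).trans (hG.curvature_max 0)

lemma norm_taylor_remainder_le (hG : SlenderGeom cΓ κmax X en1 en2) (s t : ℝ) :
    ‖X s - X (s - t) - t • deriv X s‖ ≤ κmax * t ^ 2 := by
  have hX : Differentiable ℝ X := hG.smooth.differentiable (by norm_num)
  have hX' : Differentiable ℝ (deriv X) :=
    ((contDiff_succ_iff_deriv (n := 1)).1 hG.smooth).2.2.differentiable (by norm_num)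
  have hκ := hG.curvature_nonneg
  have hLip (u : ℝ) : ‖deriv X s - deriv X (s - u)‖ ≤ κmax * |u| := by
    have := convex_univ.norm_image_sub_le_of_norm_deriv_le (f := deriv X) (𝕜 := ℝ)
      (fun x _ => hX' x) (fun x _ => hG.curvature_max x) (Set.mem_univ (s - u)) (Set.mem_univ s)
    simpa using this
  have hd (u : ℝ) : HasDerivAt (fun u => X (s - u) + u • deriv X s)
      (-deriv X (s - u) + deriv X s) u := by
    have h1 : HasDerivAt (fun u => X (s - u)) (-deriv X (s - u)) u := by
      have := (hX (s - u)).hasDerivAt.scomp u ((hasDerivAt_id u).const_sub s)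
      simpa [Function.comp_def] using this
    have h2 : HasDerivAt (fun u : ℝ => u • deriv X s) (deriv X s) u := by
      simpa using (hasDerivAt_id u).smul_const (deriv X s)
    exact h1.add h2
  have := (convex_uIcc (0 : ℝ) t).norm_image_sub_le_of_norm_hasDerivWithin_le
    (f := fun u => X (s - u) + u • deriv X s) (C := κmax * |t|)
    (fun u _ => (hd u).hasDerivWithinAt)
    (fun u hu => by
      rw [neg_add_eq_sub]
      refine (hLip u).trans (mul_le_mul_of_nonneg_left ?_ hκ)
      simpa using Set.abs_sub_left_of_mem_uIcc hu)
    Set.left_mem_uIcc Set.right_mem_uIcc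
  simp only [sub_zero, zero_smul, add_zero, Real.norm_eq_abs] at this
  rw [mul_assoc, abs_mul_abs_self, ← pow_two] at this
  rwa [← norm_neg, show -(X s - X (s - t) - t • deriv X s) =
    X (s - t) + t • deriv X s - X s by abel]

lemma inner_deriv_ePerp (hG : SlenderGeom cΓ κmax X en1 en2) (s θ : ℝ) :
    ⟪deriv X s, ePerp en1 en2 s θ⟫ = 0 := by
  simp [ePerp, inner_add_right, inner_smul_right, hG.es_en1, hG.es_en2]

lemma norm_ePerp (hG : SlenderGeom cΓ κmax X en1 en2) (s θ : ℝ) :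
    ‖ePerp en1 en2 s θ‖ = 1 := by
  have h : ‖ePerp en1 en2 s θ‖ ^ 2 = 1 := by
    rw [ePerp, norm_add_sq_real, norm_smul, norm_smul, hG.en1_unit, hG.en2_unit,
      inner_smul_left, inner_smul_right, hG.en1_en2]
    simp
  exact (sq_eq_sq₀ (norm_nonneg _) zero_le_one).1 (by simpa using h)

lemma abs_norm_Rvec_sq_sub_le (hG : SlenderGeom cΓ κmax X en1 en2) {ε t : ℝ} (hε : 0 ≤ ε)
    (ht : |t| ≤ 1) (s θ : ℝ) :
    |‖Rvec X en1 en2 ε s t θ‖ ^ 2 - (t ^ 2 + ε ^ 2)|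
      ≤ (2 * κmax + κmax ^ 2) * (|t| + ε) * t ^ 2 := by
  have hκ := hG.curvature_nonneg
  set q := X s - X (s - t) - t • deriv X s with hq
  have hqn : ‖q‖ ≤ κmax * t ^ 2 := hG.norm_taylor_remainder_le s t
  set v := t • deriv X s + ε • ePerp en1 en2 s θ with hv
  have hR : Rvec X en1 en2 ε s t θ = v + q := by
    rw [Rvec, hv, hq]; abel
  have hvsq : ‖v‖ ^ 2 = t ^ 2 + ε ^ 2 := by
    rw [hv, norm_add_sq_real, norm_smul, norm_smul, hG.norm_ePerp, hG.arclength,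
      inner_smul_left, inner_smul_right, hG.inner_deriv_ePerp]
    simp
  have hvn : ‖v‖ ≤ |t| + ε := by
    refine (norm_add_le _ _).trans_eq ?_
    rw [norm_smul, norm_smul, hG.norm_ePerp, hG.arclength, Real.norm_eq_abs, Real.norm_eq_abs,
      abs_of_nonneg hε]
    ring
  rw [hR, norm_add_sq_real, hvsq]
  have hin : |⟪v, q⟫| ≤ (|t| + ε) * (κmax * t ^ 2) :=
    (abs_real_inner_le_norm v q).trans (by gcongr)
  have hq2 : ‖q‖ ^ 2 ≤ κmax ^ 2 * (|t| + ε) * t ^ 2 := by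
    calc ‖q‖ ^ 2 ≤ (κmax * t ^ 2) ^ 2 := by gcongr
      _ = κmax ^ 2 * (|t| * |t|) * t ^ 2 := by rw [abs_mul_abs_self]; ring
      _ ≤ κmax ^ 2 * (|t| + ε) * t ^ 2 := by
        gcongr
        nlinarith [abs_nonneg t]
  rw [show t ^ 2 + ε ^ 2 + 2 * ⟪v, q⟫ + ‖q‖ ^ 2 - (t ^ 2 + ε ^ 2) = 2 * ⟪v, q⟫ + ‖q‖ ^ 2 by ring]
  have h0 := sq_nonneg ‖q‖
  obtain ⟨h1, h2⟩ := abs_le.1 hin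
  exact abs_le.2 ⟨by nlinarith, by nlinarith⟩

/-- On a thin tube around the curve, `|R|²` dominates a fixed multiple of `s̄² + ε²`. -/
lemma sq_add_sq_le_norm_Rvec_sq (hG : SlenderGeom cΓ κmax X en1 en2) (hcΓ : 0 < cΓ)
    {r ε t : ℝ} (hr : (2 * κmax + κmax ^ 2) * (2 * r) ≤ 1 / 2)
    (hε : 0 ≤ ε) (hεr : ε ≤ r) (hεc : ε ≤ cΓ * r / 2) (ht : |t| ≤ 1 / 2) (s θ : ℝ) :
    t ^ 2 + ε ^ 2 ≤ (2 + 2 / cΓ) ^ 2 * ‖Rvec X en1 en2 ε s t θ‖ ^ 2 := by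
  have hκ := hG.curvature_nonneg
  have hc : 0 < 2 / cΓ := by positivity
  have hRsq := sq_nonneg ‖Rvec X en1 en2 ε s t θ‖
  rcases le_total |t| r with htr | htr
  · have h := (abs_le.1 (hG.abs_norm_Rvec_sq_sub_le hε (by linarith) s θ (t := t))).1
    have h1 : (2 * κmax + κmax ^ 2) * (|t| + ε) ≤ 1 / 2 :=
      (mul_le_mul_of_nonneg_left (by linarith) (by positivity)).trans hr
    have h2 : (2 * κmax + κmax ^ 2) * (|t| + ε) * t ^ 2 ≤ 1 / 2 * t ^ 2 := by gcongr
    have h3 : t ^ 2 + ε ^ 2 ≤ 2 * ‖Rvec X en1 en2 ε s t θ‖ ^ 2 := by nlinarith [sq_nonneg ε]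
    nlinarith [mul_nonneg hc.le hRsq, mul_nonneg (sq_nonneg (2 / cΓ)) hRsq]
  · have hX : cΓ * |t| ≤ ‖X s - X (s - t)‖ := by
      simpa using hG.no_self_intersect s (s - t) (by simpa using ht)
    have hX' : ‖X s - X (s - t)‖ ≤ ‖Rvec X en1 en2 ε s t θ‖ + ε := by
      have : X s - X (s - t) = Rvec X en1 en2 ε s t θ - ε • ePerp en1 en2 s θ := by
        rw [Rvec]; abel
      rw [this]
      refine (norm_sub_le _ _).trans_eq ?_
      rw [norm_smul, hG.norm_ePerp, Real.norm_eq_abs, abs_of_nonneg hε, mul_one]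
    have hεt : ε ≤ cΓ * |t| / 2 := hεc.trans (by gcongr)
    have hεR : ε ≤ ‖Rvec X en1 en2 ε s t θ‖ := by linarith
    have htR : |t| ≤ 2 / cΓ * ‖Rvec X en1 en2 ε s t θ‖ := by
      rw [div_mul_eq_mul_div, le_div_iff₀ hcΓ]; linarith
    have h1 : t ^ 2 ≤ (2 / cΓ * ‖Rvec X en1 en2 ε s t θ‖) ^ 2 := by
      rw [← sq_abs]; gcongr
    have h2 : ε ^ 2 ≤ ‖Rvec X en1 en2 ε s t θ‖ ^ 2 := by gcongr
    nlinarith [mul_nonneg hc.le hRsq]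

end SlenderGeom

lemma abs_inv_pow_sub_inv_pow_le {a b L c : ℝ} (ha : 0 < a) (hb : 0 < b) (hL : 1 ≤ L)
    (hba : b ≤ L * a) (hab : |a ^ 2 - b ^ 2| ≤ c * b ^ 3) (n : ℕ) :
    |(a ^ n)⁻¹ - (b ^ n)⁻¹| ≤ c * L * n * L ^ (n - 1) * (b ^ (n - 1))⁻¹ := by
  have hc : 0 ≤ c := by
    by_contra! h
    have := abs_nonneg (a ^ 2 - b ^ 2)
    nlinarith [mul_neg_of_neg_of_pos h (pow_pos hb 3)]
  have hainv : a⁻¹ ≤ L * b⁻¹ := by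
    rw [← div_eq_mul_inv, le_div_iff₀ hb, inv_mul_le_iff₀ ha]
    linarith
  have hbinv : b⁻¹ ≤ L * b⁻¹ := le_mul_of_one_le_left (by positivity) hL
  have hfirst : |a⁻¹ - b⁻¹| ≤ c * L := by
    have h1 : |a ^ 2 - b ^ 2| = |b - a| * (a + b) := by
      rw [show a ^ 2 - b ^ 2 = -((b - a) * (a + b)) by ring, abs_neg, abs_mul,
        abs_of_pos (add_pos ha hb)]
    rw [inv_sub_inv ha.ne' hb.ne', abs_div, abs_of_pos (mul_pos ha hb),
      div_le_iff₀ (mul_pos ha hb)]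
    have h2 : |b - a| * b ≤ c * b ^ 3 :=
      (mul_le_mul_of_nonneg_left (by linarith) (abs_nonneg _)).trans (h1 ▸ hab)
    have h3 : |b - a| ≤ c * b ^ 2 := by
      refine le_of_mul_le_mul_right (h2.trans_eq ?_) hb
      ring
    calc |b - a| ≤ c * (b * b) := by rw [← pow_two]; exact h3
      _ ≤ c * (L * a * b) := by gcongr
      _ = c * L * (a * b) := by ring
  have h := abs_pow_sub_pow_le a⁻¹ b⁻¹ n
  rw [abs_of_pos (inv_pos.2 ha), abs_of_pos (inv_pos.2 hb)] at h
  rw [← inv_pow, ← inv_pow]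
  calc _ ≤ |a⁻¹ - b⁻¹| * n * max a⁻¹ b⁻¹ ^ (n - 1) := h
    _ ≤ c * L * n * (L * b⁻¹) ^ (n - 1) := by
      gcongr
      exact max_le hainv hbinv
    _ = _ := by rw [mul_pow, inv_pow]; ring

lemma integrable_abs_pow_mul_inv_sqrt_pow {m p : ℕ} (h : m + 2 ≤ p) :
    Integrable fun t : ℝ => |t| ^ m * (√(t ^ 2 + 1) ^ p)⁻¹ := by
  refine (integrable_inv_one_add_sq).mono' ?_ (Filter.Eventually.of_forall fun t => ?_)
  · have : Continuous fun t : ℝ => |t| ^ m * (√(t ^ 2 + 1) ^ p)⁻¹ := by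
      refine Continuous.mul (by fun_prop) (Continuous.inv₀ (by fun_prop) fun t => ?_)
      positivity
    exact this.aestronglyMeasurable
  · have h1 : 1 ≤ √(t ^ 2 + 1) := Real.one_le_sqrt.2 (by nlinarith [sq_nonneg t])
    have h2 : |t| ≤ √(t ^ 2 + 1) := Real.abs_le_sqrt (by linarith)
    have h3 : √(t ^ 2 + 1) ^ 2 = 1 + t ^ 2 := by rw [Real.sq_sqrt (by positivity), add_comm]
    rw [Real.norm_of_nonneg (by positivity), ← h3, ← div_eq_mul_inv,
      div_le_iff₀ (by positivity), inv_mul_eq_div, le_div_iff₀ (by positivity)]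
    calc |t| ^ m * √(t ^ 2 + 1) ^ 2 ≤ √(t ^ 2 + 1) ^ m * √(t ^ 2 + 1) ^ 2 := by gcongr
      _ = √(t ^ 2 + 1) ^ (m + 2) := (pow_add _ _ _).symm
      _ ≤ √(t ^ 2 + 1) ^ p := pow_le_pow_right₀ h1 h

lemma sqrt_mul_sq_add_sq {η : ℝ} (hη : 0 < η) (t : ℝ) :
    √((η * t) ^ 2 + η ^ 2) = η * √(t ^ 2 + 1) := by
  rw [show (η * t) ^ 2 + η ^ 2 = η ^ 2 * (t ^ 2 + 1) by ring, Real.sqrt_mul (sq_nonneg _),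
    Real.sqrt_sq hη.le]

lemma abs_mul_pow_mul_inv_sqrt_pow {η : ℝ} (hη : 0 < η) (m p : ℕ) (t : ℝ) :
    |η * t| ^ m * (√((η * t) ^ 2 + η ^ 2) ^ p)⁻¹
      = η ^ m * (η ^ p)⁻¹ * (|t| ^ m * (√(t ^ 2 + 1) ^ p)⁻¹) := by
  rw [sqrt_mul_sq_add_sq hη, abs_mul, abs_of_pos hη, mul_pow, mul_pow, mul_inv]
  ring

lemma integrable_abs_pow_mul_inv_sqrt_pow_scaled {m p : ℕ} (h : m + 2 ≤ p) {η : ℝ} (hη : 0 < η) :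
    Integrable fun t : ℝ => |t| ^ m * (√(t ^ 2 + η ^ 2) ^ p)⁻¹ := by
  rw [← integrable_comp_mul_left_iff _ hη.ne']
  simp_rw [abs_mul_pow_mul_inv_sqrt_pow hη]
  exact (integrable_abs_pow_mul_inv_sqrt_pow h).const_mul _

lemma integral_abs_pow_mul_inv_sqrt_pow_scaled (m p : ℕ) {η : ℝ} (hη : 0 < η) :
    ∫ t : ℝ, |t| ^ m * (√(t ^ 2 + η ^ 2) ^ p)⁻¹
      = η ^ ((m : ℝ) + 1 - p) * ∫ t : ℝ, |t| ^ m * (√(t ^ 2 + 1) ^ p)⁻¹ := by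
  have h := Measure.integral_comp_mul_left
    (fun t : ℝ => |t| ^ m * (√(t ^ 2 + η ^ 2) ^ p)⁻¹) η
  simp_rw [abs_mul_pow_mul_inv_sqrt_pow hη] at h
  rw [integral_const_mul, abs_of_pos (inv_pos.2 hη), smul_eq_mul, eq_inv_mul_iff_mul_eq₀ hη.ne'] at h
  rw [← h, Real.rpow_sub hη, Real.rpow_add hη, Real.rpow_one, Real.rpow_natCast,
    Real.rpow_natCast]
  ring

lemma Real.rpow_natCast_div_two_eq_sqrt_pow {x : ℝ} (hx : 0 ≤ x) (n : ℕ) :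
    x ^ ((n : ℝ) / 2) = √x ^ n := by
  rw [Real.rpow_div_two_eq_sqrt _ hx, Real.rpow_natCast]

lemma norm_le_C0norm {f : ℝ → V3} (hf : Continuous f) (hper : Function.Periodic f 1) (x : ℝ) :
    ‖f x‖ ≤ C0norm f := by
  refine le_ciSup (f := fun s => ‖f s‖) ?_ x
  obtain ⟨K, hK⟩ := (isCompact_Icc (a := (0 : ℝ)) (b := 1)).exists_bound_of_continuousOn
    hf.continuousOn
  refine ⟨K, ?_⟩
  rintro _ ⟨s, rfl⟩
  obtain ⟨y, hy, hsy⟩ := hper.exists_mem_Ico₀ one_pos s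
  simpa [hsy] using hK y ⟨hy.1, hy.2.le⟩

lemma Function.Periodic.deriv_periodic {f : ℝ → V3} {c : ℝ} (hper : Function.Periodic f c) :
    Function.Periodic (deriv f) c := fun x => by
  rw [← deriv_comp_add_const, show (fun x => f (x + c)) = f from funext hper]

lemma bddAbove_range_C0norm {f : ℝ → ℝ → V3} (hf : Continuous fun p : ℝ × ℝ => f p.1 p.2)
    (hper : ∀ θ, Function.Periodic (fun sb => f sb θ) 1) (a b : ℝ) :
    ∃ K, ∀ θ ∈ Set.Icc a b, C0norm (fun sb => f sb θ) ≤ K := by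
  obtain ⟨K, hK⟩ := ((isCompact_Icc (a := (0 : ℝ)) (b := 1)).prod
    (isCompact_Icc (a := a) (b := b))).exists_bound_of_continuousOn hf.continuousOn
  refine ⟨K, fun θ hθ => ciSup_le fun s => ?_⟩
  obtain ⟨y, hy, hsy⟩ := (hper θ).exists_mem_Ico₀ one_pos s
  exact (congrArg norm hsy).trans_le (hK (y, θ) ⟨⟨hy.1, hy.2.le⟩, hθ⟩)

/-- Bounds of `g(·,θ)` and of its increments at `0` by the sup over `θ` of the `C¹` norms. -/
lemma norm_le_iSup_C1norm {g : ℝ → ℝ → V3} (hg : Continuous fun p : ℝ × ℝ => g p.1 p.2)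
    (hg1 : ∀ θ, ContDiff ℝ 1 fun sb => g sb θ)
    (hg' : Continuous fun p : ℝ × ℝ => deriv (fun u => g u p.2) p.1)
    (hper : ∀ sb θ, g (sb + 1) θ = g sb θ) {T θ : ℝ} (hθ : θ ∈ Set.Ico 0 T) (t : ℝ) :
    ‖g t θ‖ ≤ (⨆ θ : Set.Ico (0 : ℝ) T, C1norm fun sb => g sb θ.1) ∧
      ‖g t θ - g 0 θ‖ ≤ (⨆ θ : Set.Ico (0 : ℝ) T, C1norm fun sb => g sb θ.1) * |t| := by
  have hp (θ : ℝ) : Function.Periodic (fun sb => g sb θ) 1 := fun sb => hper sb θ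
  have hp' (θ : ℝ) : Function.Periodic (fun sb => deriv (fun u => g u θ) sb) 1 :=
    (hp θ).deriv_periodic
  obtain ⟨K, hK⟩ := bddAbove_range_C0norm hg hp 0 T
  obtain ⟨K', hK'⟩ := bddAbove_range_C0norm hg' hp' 0 T
  have hle : C1norm (fun sb => g sb θ) ≤
      ⨆ θ : Set.Ico (0 : ℝ) T, C1norm fun sb => g sb θ.1 := by
    refine le_ciSup (f := fun θ : Set.Ico (0 : ℝ) T => C1norm fun sb => g sb θ.1) ?_ ⟨θ, hθ⟩
    refine ⟨K + K', ?_⟩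
    rintro _ ⟨φ, rfl⟩
    exact add_le_add (hK φ ⟨φ.2.1, φ.2.2.le⟩) (hK' φ ⟨φ.2.1, φ.2.2.le⟩)
  have h0 (x : ℝ) : ‖g x θ‖ ≤ C0norm fun sb => g sb θ :=
    norm_le_C0norm (hg1 θ).continuous (hp θ) x
  have h1 (x : ℝ) : ‖deriv (fun u => g u θ) x‖ ≤ C0norm (deriv fun sb => g sb θ) :=
    norm_le_C0norm ((hg1 θ).continuous_deriv le_rfl) (hp θ).deriv_periodic x
  have h0' := (norm_nonneg _).trans (h0 0)
  have h1' := (norm_nonneg _).trans (h1 0)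
  rw [C1norm] at hle
  refine ⟨by linarith [h0 t], ?_⟩
  have := convex_univ.norm_image_sub_le_of_norm_deriv_le (f := fun u => g u θ) (𝕜 := ℝ)
    (fun x _ => ((hg1 θ).differentiable (by norm_num)) x) (fun x _ => h1 x)
    (Set.mem_univ 0) (Set.mem_univ t)
  rw [sub_zero, Real.norm_eq_abs] at this
  exact this.trans (by gcongr; linarith)

/-- Comparison of a truncated kernel integral with its model `|t|^m (t² + η²)^{-n/2}` on the
line. -/
lemma norm_kernel_integral_sub_le {m n : ℕ} (hm : Even m) (hmn : m + 3 ≤ n) {η D M : ℝ}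
    (hη : 0 < η) (hD : 0 ≤ D) {k : ℝ → ℝ} {G : ℝ → V3} (hk : Continuous k) (hG : Continuous G)
    (hkD : ∀ t, |t| ≤ 1 / 2 →
      |k t - (√(t ^ 2 + η ^ 2) ^ n)⁻¹| ≤ D * (√(t ^ 2 + η ^ 2) ^ (n - 1))⁻¹)
    (hGM : ∀ t, ‖G t‖ ≤ M) (hGM' : ∀ t, ‖G t - G 0‖ ≤ M * |t|) :
    ‖(∫ t in (-(1 : ℝ) / 2)..(1 / 2), (t ^ m * k t) • G t)
        - (η ^ ((m : ℝ) + 1 - n) * ∫ τ : ℝ, |τ| ^ m * (√(τ ^ 2 + 1) ^ n)⁻¹) • G 0‖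
      ≤ (D + 2) * M * (η ^ ((m : ℝ) + 2 - n)
          * ∫ τ : ℝ, |τ| ^ m * (√(τ ^ 2 + 1) ^ (n - 1))⁻¹) := by
  have hM : 0 ≤ M := (norm_nonneg _).trans (hGM 0)
  have hexp : (m : ℝ) + 2 - n = (m : ℝ) + 1 - ((n - 1 : ℕ) : ℝ) := by
    rw [Nat.cast_sub (by omega)]; push_cast; ring
  rw [hexp, ← integral_abs_pow_mul_inv_sqrt_pow_scaled m n hη,
    ← integral_abs_pow_mul_inv_sqrt_pow_scaled m (n - 1) hη,
    intervalIntegral.integral_of_le (by norm_num), ← integral_indicator measurableSet_Ioc,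
    ← integral_smul_const, ← integral_const_mul, ← integral_sub]
  · refine norm_integral_le_of_norm_le
      ((integrable_abs_pow_mul_inv_sqrt_pow_scaled (by omega) hη).const_mul _)
      (Filter.Eventually.of_forall fun t => ?_)
    have hb : 0 < √(t ^ 2 + η ^ 2) := Real.sqrt_pos.2 (by positivity)
    have htb : |t| ≤ √(t ^ 2 + η ^ 2) := Real.abs_le_sqrt (by nlinarith [sq_nonneg η])
    have hkD' := hkD t
    set b := √(t ^ 2 + η ^ 2) with hbdef
    have hbn : (b ^ n)⁻¹ * |t| ≤ (b ^ (n - 1))⁻¹ := by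
      rw [show n = (n - 1) + 1 by omega, pow_succ, mul_inv, mul_assoc]
      refine mul_le_of_le_one_right (by positivity) ?_
      rw [inv_mul_le_iff₀ hb]
      simpa using htb
    by_cases ht : t ∈ Set.Ioc (-(1 : ℝ) / 2) (1 / 2)
    · rw [Set.indicator_of_mem ht]
      have hsplit : (t ^ m * k t) • G t - (|t| ^ m * (b ^ n)⁻¹) • G 0
          = |t| ^ m • ((k t - (b ^ n)⁻¹) • G t + (b ^ n)⁻¹ • (G t - G 0)) := by
        rw [hm.pow_abs]
        module
      have ht' : |t| ≤ 1 / 2 := abs_le.2 ⟨by linarith [ht.1], ht.2⟩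
      rw [hsplit, norm_smul, norm_pow, Real.norm_eq_abs, abs_abs]
      calc |t| ^ m * ‖(k t - (b ^ n)⁻¹) • G t + (b ^ n)⁻¹ • (G t - G 0)‖
          ≤ |t| ^ m * (D * (b ^ (n - 1))⁻¹ * M + (b ^ (n - 1))⁻¹ * M) := by
            gcongr
            refine (norm_add_le _ _).trans (add_le_add ?_ ?_)
            · rw [norm_smul, Real.norm_eq_abs]
              exact mul_le_mul (hkD' ht') (hGM t) (norm_nonneg _) (by positivity)
            · rw [norm_smul, Real.norm_of_nonneg (by positivity)]
              calc (b ^ n)⁻¹ * ‖G t - G 0‖ ≤ (b ^ n)⁻¹ * (M * |t|) := by gcongr; exact hGM' t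
                _ = (b ^ n)⁻¹ * |t| * M := by ring
                _ ≤ _ := by gcongr
        _ = (D + 1) * M * (|t| ^ m * (b ^ (n - 1))⁻¹) := by ring
        _ ≤ _ := by gcongr; norm_num
    · rw [Set.indicator_of_notMem ht, zero_sub, norm_neg, norm_smul,
        Real.norm_of_nonneg (by positivity)]
      have ht' : 1 ≤ 2 * |t| := by
        by_contra! h
        obtain ⟨h1, h2⟩ := abs_lt.1 (show |t| < 1 / 2 by linarith)
        exact ht ⟨by linarith, h2.le⟩
      calc |t| ^ m * (b ^ n)⁻¹ * ‖G 0‖ ≤ |t| ^ m * ((b ^ n)⁻¹ * (2 * |t|)) * M := by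
            gcongr
            · exact le_mul_of_one_le_right (by positivity) ht'
            · exact hGM 0
        _ = 2 * M * (|t| ^ m * ((b ^ n)⁻¹ * |t|)) := by ring
        _ ≤ (D + 2) * M * (|t| ^ m * (b ^ (n - 1))⁻¹) := by
            gcongr
            linarith
  · rw [integrable_indicator_iff measurableSet_Ioc]
    exact (Continuous.integrableOn_Icc (by fun_prop)).mono_set Set.Ioc_subset_Icc_self
  · exact (integrable_abs_pow_mul_inv_sqrt_pow_scaled (by omega) hη).smul_const _

lemma SlenderGeom.abs_kernel_sub_le {cΓ κmax : ℝ} {X en1 en2 : ℝ → V3}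
    (hG : SlenderGeom cΓ κmax X en1 en2) (hcΓ : 0 < cΓ)
    {r ε δ t : ℝ} (hr : (2 * κmax + κmax ^ 2) * (2 * r) ≤ 1 / 2)
    (hε : 0 < ε) (hεr : ε ≤ r) (hεc : ε ≤ cΓ * r / 2) (hδ : 0 < δ) (ht : |t| ≤ 1 / 2)
    (n : ℕ) (s θ : ℝ) :
    |(√(‖Rvec X en1 en2 ε s t θ‖ ^ 2 + δ ^ 2) ^ n)⁻¹ - (√(t ^ 2 + √(ε ^ 2 + δ ^ 2) ^ 2) ^ n)⁻¹|
      ≤ 2 * (2 * κmax + κmax ^ 2) * (2 + 2 / cΓ) * n * (2 + 2 / cΓ) ^ (n - 1)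
        * (√(t ^ 2 + √(ε ^ 2 + δ ^ 2) ^ 2) ^ (n - 1))⁻¹ := by
  have hκ := hG.curvature_nonneg
  have hc : 0 < 2 / cΓ := by positivity
  have hL : 1 ≤ 2 + 2 / cΓ := by linarith
  rw [Real.sq_sqrt (by positivity)]
  have hlow := hG.sq_add_sq_le_norm_Rvec_sq hcΓ hr hε.le hεr hεc ht s θ
  have hup := hG.abs_norm_Rvec_sq_sub_le hε.le (ht.trans (by norm_num)) s θ
  refine abs_inv_pow_sub_inv_pow_le (Real.sqrt_pos.2 (by positivity))
    (Real.sqrt_pos.2 (by positivity)) hL ?_ ?_ n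
  · rw [← Real.sqrt_sq (zero_le_one.trans hL), ← Real.sqrt_mul (sq_nonneg _)]
    refine Real.sqrt_le_sqrt ?_
    nlinarith [mul_nonneg (sub_nonneg.2 (one_le_pow₀ hL (n := 2))) (sq_nonneg δ)]
  · rw [Real.sq_sqrt (by positivity), Real.sq_sqrt (by positivity),
      show ‖Rvec X en1 en2 ε s t θ‖ ^ 2 + δ ^ 2 - (t ^ 2 + (ε ^ 2 + δ ^ 2))
        = ‖Rvec X en1 en2 ε s t θ‖ ^ 2 - (t ^ 2 + ε ^ 2) by ring]
    have h1 : |t| ≤ √(t ^ 2 + (ε ^ 2 + δ ^ 2)) :=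
      Real.abs_le_sqrt (by nlinarith [sq_nonneg ε, sq_nonneg δ])
    have h2 : ε ≤ √(t ^ 2 + (ε ^ 2 + δ ^ 2)) :=
      Real.le_sqrt_of_sq_le (by nlinarith [sq_nonneg t, sq_nonneg δ])
    set b := √(t ^ 2 + (ε ^ 2 + δ ^ 2))
    calc _ ≤ (2 * κmax + κmax ^ 2) * (|t| + ε) * t ^ 2 := hup
      _ = (2 * κmax + κmax ^ 2) * (|t| + ε) * |t| ^ 2 := by rw [sq_abs]
      _ ≤ (2 * κmax + κmax ^ 2) * (b + b) * b ^ 2 := by gcongr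
      _ = _ := by ring

/-- θ-integrated leading-order asymptotics: for even `m ≥ 0`, `n ≥ m+3`,
and `g(s̄,θ)` continuous in `θ` and `C¹` in `s̄` uniformly in `θ`, the doubly-integrated
kernel equals `(ε²+δ²)^{(m+1−n)/2} d_{mn} ∫_0^{2π} g(0,θ) dθ` up to
`C max_θ ‖g(·,θ)‖_{C¹} (ε²+δ²)^{(m+2−n)/2}`. -/
theorem kernel_integral_theta_averaged (m n : ℕ) (hm : Even m) (hmn : m + 3 ≤ n)
    (cΓ κmax : ℝ) (hcΓ : 0 < cΓ) :
    ∃ C > 0, ∃ ε₀ > 0,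
      ∀ X en1 en2 : ℝ → V3, SlenderGeom cΓ κmax X en1 en2 →
      ∀ g : ℝ → ℝ → V3,
        Continuous (fun p : ℝ × ℝ => g p.1 p.2) →
        (∀ θ, ContDiff ℝ 1 fun sb => g sb θ) →
        Continuous (fun p : ℝ × ℝ => deriv (fun u => g u p.2) p.1) →
        (∀ sb θ, g (sb + 1) θ = g sb θ) →
      ∀ ε δ : ℝ, 0 < ε → ε < ε₀ → 0 < δ → δ < ε₀ →
      ∀ s : ℝ,
        ‖(∫ θ in (0:ℝ)..(2 * Real.pi), ∫ sb in (-(1:ℝ)/2)..(1/2),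
              (sb ^ m * ((‖Rvec X en1 en2 ε s sb θ‖ ^ 2 + δ ^ 2) ^ ((n : ℝ) / 2))⁻¹)
                • g sb θ)
            - ((ε ^ 2 + δ ^ 2) ^ (((m : ℝ) + 1 - n) / 2)
                  * ∫ τ : ℝ, τ ^ m * ((τ ^ 2 + 1) ^ ((n : ℝ) / 2))⁻¹)
                • ∫ θ in (0:ℝ)..(2 * Real.pi), g 0 θ‖
          ≤ C * (⨆ θ : Set.Ico (0:ℝ) (2 * Real.pi), C1norm fun sb => g sb θ.1)
              * (ε ^ 2 + δ ^ 2) ^ (((m : ℝ) + 2 - n) / 2) := by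
  set L : ℝ := 2 + 2 / cΓ with hL
  set J : ℝ := ∫ τ : ℝ, |τ| ^ m * (√(τ ^ 2 + 1) ^ (n - 1))⁻¹ with hJdef
  have hJ : 0 ≤ J := integral_nonneg fun τ => by positivity
  set D : ℝ := 2 * (2 * |κmax| + κmax ^ 2) * L * n * L ^ (n - 1) with hDdef
  have hD : 0 ≤ D := by positivity
  set r : ℝ := 1 / (4 * (2 * |κmax| + κmax ^ 2 + 1)) with hr
  refine ⟨(D + 2) * J * (2 * Real.pi) + 1, by positivity, min r (cΓ * r / 2), by positivity, ?_⟩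
  intro X en1 en2 hG g hg hg1 hg' hper ε δ hε hε₀ hδ _ s
  have hκ : |κmax| = κmax := abs_of_nonneg hG.curvature_nonneg
  have hκ0 := hG.curvature_nonneg
  rw [hκ] at hr hDdef
  have hr' : (2 * κmax + κmax ^ 2) * (2 * r) ≤ 1 / 2 := by
    rw [hr, ← mul_assoc, mul_one_div, div_le_div_iff₀ (by positivity) (by norm_num)]
    linarith
  set M : ℝ := ⨆ θ : Set.Ico (0 : ℝ) (2 * Real.pi), C1norm fun sb => g sb θ.1
  have hM {θ : ℝ} (hθ : θ ∈ Set.Ico 0 (2 * Real.pi)) (t : ℝ) :=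
    norm_le_iSup_C1norm hg hg1 hg' hper hθ t
  have hM0 : 0 ≤ M := (norm_nonneg _).trans (hM (θ := 0) ⟨le_rfl, by positivity⟩ 0).1
  set η : ℝ := √(ε ^ 2 + δ ^ 2) with hηdef
  have hη : 0 < η := Real.sqrt_pos.2 (by positivity)
  have hXc : Continuous X := hG.smooth.continuous
  have hkc : Continuous fun p : ℝ × ℝ =>
      (√(‖Rvec X en1 en2 ε s p.2 p.1‖ ^ 2 + δ ^ 2) ^ n)⁻¹ := by
    refine Continuous.inv₀ ?_ fun p => ?_
    · unfold Rvec ePerp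
      fun_prop
    · have : 0 < ‖Rvec X en1 en2 ε s p.2 p.1‖ ^ 2 + δ ^ 2 := by positivity
      positivity
  have hgc : Continuous fun p : ℝ × ℝ => g p.2 p.1 := hg.comp continuous_swap
  have hI : (∫ τ : ℝ, τ ^ m * ((τ ^ 2 + 1) ^ ((n : ℝ) / 2))⁻¹)
      = ∫ τ : ℝ, |τ| ^ m * (√(τ ^ 2 + 1) ^ n)⁻¹ := by
    refine integral_congr_ae (Filter.Eventually.of_forall fun τ => ?_)
    simp only
    rw [hm.pow_abs, Real.rpow_natCast_div_two_eq_sqrt_pow (by positivity)]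
  have hF : Continuous fun θ : ℝ => ∫ t in (-(1 : ℝ) / 2)..(1 / 2),
      (t ^ m * (√(‖Rvec X en1 en2 ε s t θ‖ ^ 2 + δ ^ 2) ^ n)⁻¹) • g t θ := by
    refine intervalIntegral.continuous_parametric_intervalIntegral_of_continuous' ?_ _ _
    exact ((continuous_snd.pow m).mul hkc).smul hgc
  have hRpow (t θ : ℝ) : (‖Rvec X en1 en2 ε s t θ‖ ^ 2 + δ ^ 2) ^ ((n : ℝ) / 2)
      = √(‖Rvec X en1 en2 ε s t θ‖ ^ 2 + δ ^ 2) ^ n :=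
    Real.rpow_natCast_div_two_eq_sqrt_pow (by positivity) n
  simp_rw [hRpow]
  rw [hI, Real.rpow_div_two_eq_sqrt _ (by positivity), Real.rpow_div_two_eq_sqrt _ (by positivity),
    ← hηdef, ← intervalIntegral.integral_smul, ← intervalIntegral.integral_sub
      (hF.intervalIntegrable _ _)
      (Continuous.intervalIntegrable (by fun_prop) _ _)]
  have hkD (θ t : ℝ) (ht : |t| ≤ 1 / 2) :
      |(√(‖Rvec X en1 en2 ε s t θ‖ ^ 2 + δ ^ 2) ^ n)⁻¹ - (√(t ^ 2 + η ^ 2) ^ n)⁻¹|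
        ≤ D * (√(t ^ 2 + η ^ 2) ^ (n - 1))⁻¹ := by
    rw [hDdef]
    exact hG.abs_kernel_sub_le hcΓ hr' hε (hε₀.le.trans (min_le_left _ _))
      (hε₀.le.trans (min_le_right _ _)) hδ ht n s θ
  have hkθ (θ : ℝ) : Continuous fun t => (√(‖Rvec X en1 en2 ε s t θ‖ ^ 2 + δ ^ 2) ^ n)⁻¹ := by
    simpa only [Function.comp_def] using hkc.comp (Continuous.prodMk_right θ)
  have hθ {θ : ℝ} (hθ : θ ∈ Set.Ico 0 (2 * Real.pi)) :=
    norm_kernel_integral_sub_le hm hmn hη hD (hkθ θ) (hg1 θ).continuous (hkD θ)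
      (fun t => (hM hθ t).1) (fun t => (hM hθ t).2)
  refine (intervalIntegral.norm_integral_le_of_norm_le_const_ae
    (C := (D + 2) * M * (η ^ ((m : ℝ) + 2 - n) * J)) ?_).trans ?_
  · filter_upwards [Measure.ae_ne volume (2 * Real.pi)] with θ hne hmem
    rw [Set.uIoc_of_le (by positivity)] at hmem
    exact hθ ⟨hmem.1.le, lt_of_le_of_ne hmem.2 hne⟩
  · rw [sub_zero, abs_of_pos (by positivity)]
    have : 0 ≤ M * η ^ ((m : ℝ) + 2 - n) := by positivity
    linarith
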